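/- arXiv:1603.06683 — 2 statements merged into one kernel-verified Lean document; each statement's English description precedes it below -/
import Mathlib

section
/- For q ≥ 3 and n a positive divisor of q, the index [SL(2,ℤ) : ±Γ_q^n] equals (n·q²/2)·∏_{p | q, p prime}(1 - 1/p²). -/
open Matrix CongruenceSubgroup

local notation "SL2Z" => Matrix.SpecialLinearGroup (Fin 2) ℤ

/-- `±Γ` : the subgroup generated by `Γ` and `-1`. -/
def pm (Γ : Subgroup SL2Z) : Subgroup SL2Z := Γ ⊔ Subgroup.zpowers (-1)

/-- Matrices in `SL(2, ℤ)` whose upper-right entry is divisible by `n`. -/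
def GammaUpper (n : ℕ) : Subgroup SL2Z where
  carrier := { g | ((g 0 1 : ℤ) : ZMod n) = 0 }
  one_mem' := by simp
  mul_mem' := by
    intro a b ha hb
    have h := (Matrix.two_mul_expl a.1 b.1).2.1
    simp only [Set.mem_setOf_eq] at *
    rw [Matrix.SpecialLinearGroup.coe_mul, h]
    push_cast
    rw [ha, hb]
    ring
  inv_mem' := by
    intro a ha
    simp only [Set.mem_setOf_eq] at *
    rw [Matrix.SpecialLinearGroup.SL2_inv_expl a]
    simp [ha]

/-- The group `Γ_q^n`: `a ≡ d ≡ 1, c ≡ 0 (mod q)` and `b ≡ 0 (mod n)`. -/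
def GammaQN (q n : ℕ) : Subgroup SL2Z := Gamma1 q ⊓ GammaUpper n

/-- If `gcd (a, b, q) = 1` and `a ≠ 0`, some `b + k q` is coprime to `a`. -/
theorem Nat.exists_coprime_add_mul {a b q : ℕ} (ha : a ≠ 0)
    (h : ∀ p : ℕ, p.Prime → p ∣ a → p ∣ b → ¬ p ∣ q) : ∃ k : ℕ, a.Coprime (b + k * q) := by
  refine ⟨∏ p ∈ a.primeFactors with ¬ p ∣ b, p, Nat.coprime_of_dvd fun p hp hpa hpb ↦ ?_⟩
  by_cases hb : p ∣ b
  · rcases hp.dvd_mul.mp ((Nat.dvd_add_right hb).mp hpb) with hk | hq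
    · obtain ⟨r, hr, hpr⟩ := (Prime.dvd_finsetProd_iff hp.prime _).mp hk
      obtain ⟨hra, hrb⟩ := Finset.mem_filter.mp hr
      rw [(Nat.prime_dvd_prime_iff_eq hp (Nat.prime_of_mem_primeFactors hra)).mp hpr] at hb
      exact hrb hb
    · exact h p hp hpa hb hq
  · have hk : p ∣ ∏ p ∈ a.primeFactors with ¬ p ∣ b, p :=
      Finset.dvd_prod_of_mem (fun p ↦ p)
        (Finset.mem_filter.mpr ⟨Nat.mem_primeFactors.mpr ⟨hp, hpa, ha⟩, hb⟩)
    exact hb ((Nat.dvd_add_left (hk.mul_right q)).mp hpb)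

theorem ZMod.exists_SL2_int_col {q : ℕ} (hq : q ≠ 0) {a b : ZMod q} (h : IsCoprime a b) :
    ∃ g : SL2Z, ((g 0 0 : ℤ) : ZMod q) = a ∧ ((g 1 0 : ℤ) : ZMod q) = b := by
  have : NeZero q := ⟨hq⟩
  obtain ⟨k, hk⟩ := Nat.exists_coprime_add_mul (a := a.val + q) (b := b.val) (q := q) (by omega) <| by
    intro p hp hpa hpb hpq
    have : Fact p.Prime := ⟨hp⟩
    have ha := (ZMod.natCast_eq_zero_iff _ _).mpr ((Nat.dvd_add_left hpq).mp hpa)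
    have hb := (ZMod.natCast_eq_zero_iff _ _).mpr hpb
    have hc := h.map (ZMod.castHom hpq (ZMod p))
    rw [ZMod.natCast_val] at ha hb
    rw [ZMod.castHom_apply, ZMod.castHom_apply, ha, hb] at hc
    exact not_isCoprime_zero_zero hc
  obtain ⟨g, h0, h1⟩ := (Nat.isCoprime_iff_coprime.mpr hk).exists_SL2_col 0
  refine ⟨g, ?_, ?_⟩
  · rw [h0]; simp
  · rw [h1]; simp

theorem ZMod.card_isCoprime_prime_pow {p k : ℕ} (hp : p.Prime) (hk : 0 < k) :
    Nat.card {v : ZMod (p ^ k) × ZMod (p ^ k) // IsCoprime v.1 v.2} + (p ^ (k - 1)) ^ 2 =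
      (p ^ k) ^ 2 := by
  classical
  have : Fact p.Prime := ⟨hp⟩
  have : NeZero (p ^ k) := ⟨(pow_pos hp.pos k).ne'⟩
  have hunit : ∀ a : ZMod (p ^ k), IsUnit a ↔ (ZMod.castHom (dvd_pow_self p hk.ne') (ZMod p)) a ≠ 0 := by
    intro a
    obtain ⟨a, rfl⟩ := ZMod.natCast_zmod_surjective a
    rw [ZMod.isUnit_iff_coprime, map_natCast, Ne, ZMod.natCast_eq_zero_iff,
      Nat.coprime_pow_right_iff hk, Nat.coprime_comm, hp.coprime_iff_not_dvd]
  have hcop : ∀ v : ZMod (p ^ k) × ZMod (p ^ k),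
      ¬ IsCoprime v.1 v.2 ↔ ¬ IsUnit v.1 ∧ ¬ IsUnit v.2 := by
    rintro ⟨a, b⟩
    refine ⟨fun h ↦ ⟨fun ha ↦ h ?_, fun hb ↦ h ?_⟩, ?_⟩
    · obtain ⟨u, rfl⟩ := ha
      exact ⟨↑u⁻¹, 0, by simp⟩
    · obtain ⟨u, rfl⟩ := hb
      exact ⟨0, ↑u⁻¹, by simp⟩
    · rintro ⟨ha, hb⟩ h
      have hc := h.map (ZMod.castHom (dvd_pow_self p hk.ne') (ZMod p))
      rw [hunit, not_not] at ha hb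
      simp only at ha hb hc
      rw [ha, hb] at hc
      exact not_isCoprime_zero_zero hc
  have hnon : Nat.card {a : ZMod (p ^ k) // ¬ IsUnit a} = p ^ (k - 1) := by
    have h1 : Nat.card {a : ZMod (p ^ k) // IsUnit a} = p ^ (k - 1) * (p - 1) := by
      rw [← Nat.totient_prime_pow hp hk, ← ZMod.card_units_eq_totient, ← Nat.card_eq_fintype_card]
      exact (Nat.card_congr (Equiv.ofInjective _ Units.val_injective)).symm
    have h2 : Nat.card {a : ZMod (p ^ k) // IsUnit a} + Nat.card {a : ZMod (p ^ k) // ¬ IsUnit a}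
        = p ^ k := by
      rw [← Nat.card_sum, Nat.card_congr (Equiv.sumCompl _), Nat.card_zmod]
    obtain ⟨m, rfl⟩ : ∃ m, k = m + 1 := ⟨k - 1, by omega⟩
    obtain ⟨r, rfl⟩ : ∃ r, p = r + 1 := ⟨p - 1, by have := hp.pos; omega⟩
    rw [h1] at h2
    simp only [Nat.add_sub_cancel] at h2 ⊢
    rw [pow_succ, mul_add_one] at h2
    exact Nat.add_left_cancel h2
  have hcompl : Nat.card {v : ZMod (p ^ k) × ZMod (p ^ k) // ¬ IsCoprime v.1 v.2} =
      (p ^ (k - 1)) ^ 2 := by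
    rw [Nat.card_congr (Equiv.subtypeEquivRight hcop), Nat.card_congr (Equiv.subtypeProdEquivProd
      (p := fun a ↦ ¬ IsUnit a) (q := fun b ↦ ¬ IsUnit b)), Nat.card_prod, hnon, sq]
  rw [← hcompl, ← Nat.card_sum, Nat.card_congr (Equiv.sumCompl _), Nat.card_prod, Nat.card_zmod, sq]

theorem Prod.isCoprime_iff {R S : Type*} [CommSemiring R] [CommSemiring S] {x y : R × S} :
    IsCoprime x y ↔ IsCoprime x.1 y.1 ∧ IsCoprime x.2 y.2 := by
  constructor
  · rintro ⟨u, v, h⟩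
    exact ⟨⟨u.1, v.1, congrArg Prod.fst h⟩, ⟨u.2, v.2, congrArg Prod.snd h⟩⟩
  · rintro ⟨⟨u, v, h⟩, ⟨u', v', h'⟩⟩
    exact ⟨(u, u'), (v, v'), Prod.ext h h'⟩

theorem ZMod.card_isCoprime_mul {m n : ℕ} (h : m.Coprime n) :
    Nat.card {v : ZMod (m * n) × ZMod (m * n) // IsCoprime v.1 v.2} =
      Nat.card {v : ZMod m × ZMod m // IsCoprime v.1 v.2} *
        Nat.card {v : ZMod n × ZMod n // IsCoprime v.1 v.2} := by
  rw [← Nat.card_prod, ← Nat.card_congr Equiv.subtypeProdEquivProd]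
  let e := ZMod.chineseRemainder h
  refine Nat.card_congr (Equiv.subtypeEquiv
    ((Equiv.prodCongr e.toEquiv e.toEquiv).trans (Equiv.prodProdProdComm _ _ _ _)) fun v ↦ ?_)
  have : IsCoprime v.1 v.2 ↔ IsCoprime (e v.1) (e v.2) :=
    ⟨fun h ↦ h.map e.toRingHom, fun h ↦ by simpa using h.map e.symm.toRingHom⟩
  rw [this, Prod.isCoprime_iff]
  rfl

/-- The number of unimodular pairs modulo `q` is Jordan's totient `J₂ q`. -/
theorem ZMod.card_isCoprime {q : ℕ} (hq : q ≠ 0) :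
    (Nat.card {v : ZMod q × ZMod q // IsCoprime v.1 v.2} : ℚ) =
      (q : ℚ) ^ 2 * ∏ p ∈ q.primeFactors, (1 - 1 / (p : ℚ) ^ 2) := by
  induction q using Nat.recOnPosPrimePosCoprime with
  | zero => exact absurd rfl hq
  | one =>
    have : Nat.card {v : ZMod 1 × ZMod 1 // IsCoprime v.1 v.2} = 1 := by
      rw [Nat.card_eq_one_iff_unique]
      exact ⟨inferInstance, ⟨⟨(0, 0), ⟨0, 0, Subsingleton.elim _ _⟩⟩⟩⟩
    simp [this]
  | prime_pow p k hp hk =>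
    have h := congrArg (Nat.cast (R := ℚ)) (ZMod.card_isCoprime_prime_pow hp hk)
    have hp0 : (p : ℚ) ≠ 0 := mod_cast hp.ne_zero
    obtain ⟨m, rfl⟩ : ∃ m, k = m + 1 := ⟨k - 1, by omega⟩
    rw [Nat.primeFactors_prime_pow hk.ne' hp, Finset.prod_singleton]
    push_cast at h ⊢
    rw [eq_sub_of_add_eq h]
    field_simp
    ring
  | coprime a b ha hb hab iha ihb =>
    rw [ZMod.card_isCoprime_mul hab, hab.primeFactors_mul,
      Finset.prod_union hab.disjoint_primeFactors]
    push_cast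
    rw [iha (by omega), ihb (by omega)]
    ring

/-- Sending a matrix to its first column modulo `q` identifies the cosets of `Γ₁(q)` with the
unimodular pairs modulo `q`. -/
theorem CongruenceSubgroup.index_Gamma1 {q : ℕ} (hq : q ≠ 0) :
    (Gamma1 q).index = Nat.card {v : ZMod q × ZMod q // IsCoprime v.1 v.2} := by
  let f : SL2Z → {v : ZMod q × ZMod q // IsCoprime v.1 v.2} := fun g ↦
    ⟨((g 0 0 : ℤ), (g 1 0 : ℤ)), (g.isCoprime_col 0).map (Int.castRingHom (ZMod q))⟩
  have hf : ∀ g h : SL2Z, g⁻¹ * h ∈ Gamma1 q ↔ f g = f h := by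
    intro g h
    have hg := congrArg (Int.cast (R := ZMod q)) ((Matrix.det_fin_two g.1).symm.trans g.2)
    have hh := congrArg (Int.cast (R := ZMod q)) ((Matrix.det_fin_two h.1).symm.trans h.2)
    have e00 : (g⁻¹ * h) 0 0 = g 1 1 * h 0 0 - g 0 1 * h 1 0 := by
      rw [Matrix.SpecialLinearGroup.coe_mul, Matrix.SpecialLinearGroup.coe_inv, adjugate_fin_two]
      simp [Matrix.mul_apply, Fin.sum_univ_two]
      ring
    have e10 : (g⁻¹ * h) 1 0 = - g 1 0 * h 0 0 + g 0 0 * h 1 0 := by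
      rw [Matrix.SpecialLinearGroup.coe_mul, Matrix.SpecialLinearGroup.coe_inv, adjugate_fin_two]
      simp [Matrix.mul_apply, Fin.sum_univ_two]
    have e11 : (g⁻¹ * h) 1 1 = - g 1 0 * h 0 1 + g 0 0 * h 1 1 := by
      rw [Matrix.SpecialLinearGroup.coe_mul, Matrix.SpecialLinearGroup.coe_inv, adjugate_fin_two]
      simp [Matrix.mul_apply, Fin.sum_univ_two]
    rw [Gamma1_mem, e00, e10, e11, Subtype.mk.injEq, Prod.mk.injEq]
    push_cast at hg hh ⊢
    generalize ((g 0 0 : ℤ) : ZMod q) = a at *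
    generalize ((g 0 1 : ℤ) : ZMod q) = b at *
    generalize ((g 1 0 : ℤ) : ZMod q) = c at *
    generalize ((g 1 1 : ℤ) : ZMod q) = d at *
    constructor
    · rintro ⟨h0, -, h1⟩
      exact ⟨by linear_combination ((h 0 0 : ℤ) : ZMod q) * hg - a * h0 - b * h1,
        by linear_combination ((h 1 0 : ℤ) : ZMod q) * hg - c * h0 - d * h1⟩
    · rintro ⟨rfl, rfl⟩
      exact ⟨by linear_combination hg, by linear_combination hh, by ring⟩
  refine Nat.card_congr (Equiv.ofBijective
    (Quotient.lift f fun g h hgh ↦ (hf g h).mp (QuotientGroup.leftRel_apply.mp hgh)) ⟨?_, ?_⟩)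
  · rintro ⟨g⟩ ⟨h⟩ hgh
    exact QuotientGroup.eq.mpr ((hf g h).mpr hgh)
  · rintro ⟨⟨a, b⟩, hab⟩
    obtain ⟨g, rfl, rfl⟩ := ZMod.exists_SL2_int_col hq hab
    exact ⟨(g : SL2Z ⧸ Gamma1 q), rfl⟩

/-- The upper-right entry modulo `n`, as a homomorphism on `Γ₁(q)`, for `n ∣ q`. -/
def Gamma1UpperHom {q n : ℕ} (hdvd : n ∣ q) : Gamma1 q →* Multiplicative (ZMod n) where
  toFun g := Multiplicative.ofAdd ((g.1 0 1 : ℤ) : ZMod n)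
  map_one' := by simp
  map_mul' g h := by
    have hg := congrArg (ZMod.castHom hdvd (ZMod n)) ((Gamma1_mem q g.1).mp g.2).1
    have hh := congrArg (ZMod.castHom hdvd (ZMod n)) ((Gamma1_mem q h.1).mp h.2).2.1
    rw [map_intCast, map_one] at hg hh
    rw [← ofAdd_add]
    congr 1
    simp only [Subgroup.coe_mul, Matrix.SpecialLinearGroup.coe_mul, Matrix.mul_apply,
      Fin.sum_univ_two]
    push_cast
    rw [hg, hh]
    ring

theorem relIndex_GammaQN {q n : ℕ} (hdvd : n ∣ q) :
    (GammaQN q n).relIndex (Gamma1 q) = n := by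
  have hker : (GammaQN q n).subgroupOf (Gamma1 q) = (Gamma1UpperHom hdvd).ker := by
    ext g
    exact ⟨fun h ↦ congrArg Multiplicative.ofAdd h.2, fun h ↦ ⟨g.2, Multiplicative.ofAdd.injective h⟩⟩
  have hsurj : Function.Surjective (Gamma1UpperHom hdvd) := by
    intro x
    obtain ⟨k, hk⟩ := ZMod.intCast_surjective (Multiplicative.toAdd x)
    refine ⟨⟨ModularGroup.T ^ k, ?_⟩, ?_⟩
    · simp [ModularGroup.coe_T_zpow]
    · refine Multiplicative.toAdd.injective ?_
      simp [Gamma1UpperHom, ModularGroup.coe_T_zpow, hk]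
  rw [Subgroup.relIndex, hker, Subgroup.index_ker, MonoidHom.range_eq_top.mpr hsurj,
    Nat.card_congr Subgroup.topEquiv.toEquiv, Nat.card_congr Multiplicative.toAdd, Nat.card_zmod]

theorem index_GammaQN {q n : ℕ} (hq : q ≠ 0) (hdvd : n ∣ q) :
    ((GammaQN q n).index : ℚ) =
      n * ((q : ℚ) ^ 2 * ∏ p ∈ q.primeFactors, (1 - 1 / (p : ℚ) ^ 2)) := by
  rw [← ZMod.card_isCoprime hq, ← index_Gamma1 hq,
    ← Subgroup.relIndex_mul_index (H := GammaQN q n) inf_le_left, relIndex_GammaQN hdvd,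
    Nat.cast_mul]

theorem mem_pm {Γ : Subgroup SL2Z} {g : SL2Z} : g ∈ pm Γ ↔ g ∈ Γ ∨ -g ∈ Γ := by
  constructor
  · intro h
    refine Subgroup.closure_induction (k := (Γ : Set SL2Z) ∪ Subgroup.zpowers (-1 : SL2Z))
      (p := fun g _ ↦ g ∈ Γ ∨ -g ∈ Γ) ?_ (.inl Γ.one_mem) ?_ ?_
      (by rwa [pm, Subgroup.sup_eq_closure] at h)
    · rintro x (hx | ⟨k, rfl⟩)
      · exact .inl hx
      · rcases Int.even_or_odd k with hk | hk
        · simp [hk.neg_one_zpow]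
        · simp [hk.neg_one_zpow]
    · rintro x y - - (hx | hx) (hy | hy)
      · exact .inl (mul_mem hx hy)
      · exact .inr (by simpa using mul_mem hx hy)
      · exact .inr (by simpa using mul_mem hx hy)
      · exact .inl (by simpa using mul_mem hx hy)
    · rintro x - (hx | hx)
      · exact .inl (inv_mem hx)
      · refine .inr ?_
        have : (-x)⁻¹ = -x⁻¹ := inv_eq_of_mul_eq_one_right (by simp)
        exact this ▸ inv_mem hx
  · rintro (h | h)
    · exact Subgroup.mem_sup_left h
    · have := mul_mem (Subgroup.mem_sup_left (T := Subgroup.zpowers (-1)) h)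
        (Subgroup.mem_sup_right (S := Γ) (Subgroup.mem_zpowers (-1 : SL2Z)))
      simpa [pm] using this

theorem relIndex_pm {Γ : Subgroup SL2Z} (h : -1 ∉ Γ) : Γ.relIndex (pm Γ) = 2 := by
  rw [Subgroup.relIindex_eq_two_iff']
  refine ⟨-1, mem_pm.mpr (.inr (by simp)), fun b hb ↦ ?_⟩
  have hnot : b ∈ Γ → -b ∉ Γ := fun h1 h2 ↦ h (by simpa using mul_mem h2 (inv_mem h1))
  rw [mem_pm] at hb
  rw [neg_one_mul]
  unfold Xor
  tauto

theorem neg_one_notMem_GammaQN {q n : ℕ} (hq : 3 ≤ q) : -1 ∉ GammaQN q n := by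
  intro h
  have h1 : ((-1 : ℤ) : ZMod q) = 1 := by simpa using ((Gamma1_mem q _).mp h.1).1
  have h2 : ((2 : ℕ) : ZMod q) = 0 := by
    push_cast at h1 ⊢
    linear_combination - h1
  have := Nat.le_of_dvd (by norm_num) ((ZMod.natCast_eq_zero_iff _ _).mp h2)
  omega

theorem stmt1 (q n : ℕ) (hq : 3 ≤ q) (hn : 0 < n) (hdvd : n ∣ q) :
    ((pm (GammaQN q n)).index : ℚ) = (n : ℚ) * (q : ℚ) ^ 2 / 2 * ∏ p ∈ q.primeFactors, (1 - 1 / (p : ℚ) ^ 2) := by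
  have h := index_GammaQN (by omega : q ≠ 0) hdvd
  rw [← Subgroup.relIndex_mul_index (K := pm (GammaQN q n)) le_sup_left,
    relIndex_pm (neg_one_notMem_GammaQN hq)] at h
  push_cast at h
  linear_combination h / 2
end

section
/- For q ≥ 5 and n a positive divisor of q, the number of cusps of Γ_q^n, i.e. h_q^n = #(ℚ ∪ {∞})/Γ_q^n, equals (n·q·𝒩(q/n)/2)·∏_{p | q, p prime}(1 - 1/p²), where 𝒩 is the multiplicative function with 𝒩(ℓ^r) = 1 + r(ℓ-1)/(ℓ+1) for primes ℓ. -/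
open Matrix CongruenceSubgroup

local notation "SL2Z" => Matrix.SpecialLinearGroup (Fin 2) ℤ

/-- The Möbius action of `SL(2, ℤ)` on `ℚ ∪ {∞}`, with `∞` encoded as `none`. -/
def moebius (g : Matrix.SpecialLinearGroup (Fin 2) ℤ) (x : Option ℚ) : Option ℚ :=
  match x with
  | none => if ((g.1 1 0 : ℤ) : ℚ) = 0 then none
      else some (((g.1 0 0 : ℤ) : ℚ) / ((g.1 1 0 : ℤ) : ℚ))
  | some t => if ((g.1 1 0 : ℤ) : ℚ) * t + ((g.1 1 1 : ℤ) : ℚ) = 0 then none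
      else some ((((g.1 0 0 : ℤ) : ℚ) * t + ((g.1 0 1 : ℤ) : ℚ)) /
        (((g.1 1 0 : ℤ) : ℚ) * t + ((g.1 1 1 : ℤ) : ℚ)))

/-- Two cusps are `Γ`-equivalent if some element of `Γ` maps one to the other. -/
def cuspRel (G : Subgroup (Matrix.SpecialLinearGroup (Fin 2) ℤ)) (x y : Option ℚ) : Prop :=
  ∃ γ ∈ G, moebius γ x = y

/-- The number of cusps of `Γ`, i.e. the number of `Γ`-orbits on `ℚ ∪ {∞}`. -/
noncomputable def numCusps (G : Subgroup (Matrix.SpecialLinearGroup (Fin 2) ℤ)) : ℕ :=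
  Nat.card (Quot (cuspRel G))

/-- The multiplicative function `𝒩` with `𝒩(p^r) = 1 + r(p-1)/(p+1)` for primes `p`. -/
def calN (m : ℕ) : ℚ :=
  ∏ p ∈ m.primeFactors, (1 + (m.factorization p) * ((p : ℚ) - 1) / ((p : ℚ) + 1))

/-- Over `k` full periods, a periodic predicate holds `k` times as often as over one period. -/
lemma card_filter_range_mul_of_periodic (p : ℕ → Prop) [DecidablePred p] {a : ℕ}
    (hp : Function.Periodic p a) (k : ℕ) :
    ((Finset.range (a * k)).filter p).card = k * ((Finset.range a).filter p).card := by
  induction k with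
  | zero => simp
  | succ k ih =>
    have h := Nat.filter_Ico_card_eq_of_periodic (a * k) a p hp
    rw [Nat.count_eq_card_filter_range] at h
    simp only [Finset.range_eq_Ico] at h ih ⊢
    rw [← Finset.Ico_union_Ico_eq_Ico (Nat.zero_le (a * k)) (Nat.mul_le_mul_left a k.le_succ),
      Finset.filter_union, Finset.card_union_of_disjoint, ih, Nat.mul_succ, h]
    · ring
    · exact Finset.disjoint_filter_filter (Finset.Ico_disjoint_Ico_consecutive _ _ _)

lemma card_filter_coprime_range {g q : ℕ} (hg : g ∣ q) :
    ((Finset.range q).filter (Nat.Coprime g)).card = q / g * g.totient := by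
  rcases Nat.eq_zero_or_pos g with rfl | hg0
  · simp [Nat.eq_zero_of_zero_dvd hg]
  obtain ⟨k, rfl⟩ := hg
  rw [card_filter_range_mul_of_periodic _ (Nat.periodic_coprime g), Nat.mul_div_cancel_left _ hg0,
    Nat.totient]

lemma card_filter_dvd_mul_range {q : ℕ} (hq : 0 < q) (k : ℕ) :
    ((Finset.range q).filter (fun b => q ∣ k * b)).card = q.gcd k := by
  set g := q.gcd k with hg
  have hg0 : 0 < g := Nat.gcd_pos_of_pos_left _ hq
  obtain ⟨r, hr⟩ : g ∣ q := Nat.gcd_dvd_left q k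
  have hr0 : 0 < r := Nat.pos_of_ne_zero (by rintro rfl; simp at hr; omega)
  have key : ∀ b, q ∣ k * b ↔ r ∣ b := by
    intro b
    obtain ⟨s, hs⟩ : g ∣ k := Nat.gcd_dvd_right q k
    have hcop : Nat.Coprime r s := by
      have h : g * r.gcd s = g * 1 := by
        rw [← Nat.gcd_mul_left, ← hr, ← hs, mul_one]
      exact Nat.eq_of_mul_eq_mul_left hg0 h
    rw [hr, hs, mul_assoc, Nat.mul_dvd_mul_iff_left hg0]
    exact hcop.dvd_mul_left
  simp_rw [key]
  have hper : Function.Periodic (fun b => r ∣ b) r := fun b => by simp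
  rw [hr, mul_comm g r, card_filter_range_mul_of_periodic _ hper]
  have : (Finset.range r).filter (fun b => r ∣ b) = {0} := by
    ext b
    simp only [Finset.mem_filter, Finset.mem_range, Finset.mem_singleton]
    constructor
    · rintro ⟨h1, h2⟩
      exact Nat.eq_zero_of_dvd_of_lt h2 h1
    · rintro rfl
      simp [hr0]
  simp [this]

/-- The arithmetic function `g ↦ φ(g) gcd(m, g) / g`. -/
def totientGcd (m : ℕ) : ArithmeticFunction ℚ :=
  ⟨fun g => g.totient * m.gcd g / g, by simp⟩

/-- Euler's totient as a rational-valued arithmetic function. -/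
def totientQ : ArithmeticFunction ℚ :=
  ⟨fun g => g.totient, by simp⟩

lemma isMultiplicative_totientGcd (m : ℕ) : (totientGcd m).IsMultiplicative := by
  refine ⟨by simp [totientGcd], fun {a b} hab => ?_⟩
  simp only [totientGcd, ArithmeticFunction.coe_mk, Nat.totient_mul hab, hab.gcd_mul]
  push_cast
  ring

lemma isMultiplicative_totientQ : totientQ.IsMultiplicative := by
  refine ⟨by simp [totientQ], fun {a b} hab => ?_⟩
  simp [totientQ, Nat.totient_mul hab]

lemma gcd_prime_pow {m p : ℕ} (hm : m ≠ 0) (hp : p.Prime) (j : ℕ) :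
    m.gcd (p ^ j) = p ^ min (m.factorization p) j := by
  obtain ⟨i, hi, h⟩ := (Nat.dvd_prime_pow hp).1 (Nat.gcd_dvd_right m (p ^ j))
  have := congrArg (fun t => t.factorization p) h
  simp [Nat.factorization_gcd hm (pow_ne_zero j hp.ne_zero), hp.factorization_self] at this
  rw [h, ← this]

lemma sum_range_totient_prime_pow {p : ℕ} (hp : p.Prime) (k : ℕ) :
    ∑ j ∈ Finset.range (k + 1), ((p ^ j).totient : ℚ) = (p : ℚ) ^ k := by
  have := Nat.sum_totient (p ^ k)
  rw [Nat.sum_divisors_prime_pow hp] at this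
  exact_mod_cast this

lemma sum_totient_prime_pow_mul (p : ℕ) (hp : p.Prime) (a r : ℕ) (hr : r ≤ a) (ha : 0 < a) :
    ∑ j ∈ Finset.range (a + 1),
      ((p ^ (a - j)).totient : ℚ) * ((p ^ j).totient * (p ^ min r j : ℕ) / (p ^ j : ℕ)) =
      (p : ℚ) ^ a * (1 + r * ((p : ℚ) - 1) / (p + 1)) * (1 - 1 / (p : ℚ) ^ 2) := by
  have hp0 : (p : ℚ) ≠ 0 := by exact_mod_cast hp.ne_zero
  have hp1 : (p : ℚ) + 1 ≠ 0 := by positivity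
  induction r with
  | zero =>
    obtain ⟨a, rfl⟩ : ∃ b, a = b + 1 := ⟨a - 1, by omega⟩
    have h1 : ∀ j ∈ Finset.range (a + 1),
        ((p ^ (a + 1 - (j + 1))).totient : ℚ) * ((p ^ (j + 1)).totient *
          (p ^ min 0 (j + 1) : ℕ) / (p ^ (j + 1) : ℕ)) =
        (1 - 1 / (p : ℚ)) * ((p ^ (a - j)).totient : ℚ) := by
      intro j _
      rw [Nat.totient_prime_pow_succ hp j, Nat.add_sub_add_right]
      push_cast [hp.one_le]
      simp only [zero_le, inf_of_le_left, pow_zero]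
      field_simp
      ring
    rw [Finset.sum_range_succ', Finset.sum_congr rfl h1, ← Finset.mul_sum]
    have h2 := Finset.sum_range_reflect (fun j => ((p ^ j).totient : ℚ)) (a + 1)
    simp only [Nat.add_sub_cancel] at h2
    rw [h2, sum_range_totient_prime_pow hp]
    simp only [Nat.sub_zero, Nat.totient_prime_pow_succ hp]
    push_cast [hp.one_le]
    simp
    field_simp
    ring
  | succ r ih =>
    have ih := ih (by omega)
    obtain ⟨b, rfl⟩ : ∃ b, a = b + (r + 1) := ⟨a - (r + 1), by omega⟩
    rw [show b + (r + 1) + 1 = (r + 1) + (b + 1) by ring, Finset.sum_range_add] at ih ⊢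
    have h0 : ∀ j ∈ Finset.range (r + 1),
        ((p ^ (b + (r + 1) - j)).totient : ℚ) *
          ((p ^ j).totient * (p ^ min (r + 1) j : ℕ) / (p ^ j : ℕ)) =
        ((p ^ (b + (r + 1) - j)).totient : ℚ) *
          ((p ^ j).totient * (p ^ min r j : ℕ) / (p ^ j : ℕ)) := by
      intro j hj
      rw [Finset.mem_range] at hj
      rw [min_eq_right (by omega), min_eq_right (by omega)]
    rw [Finset.sum_congr rfl h0]
    have h1 : ∀ s, s ≤ r + 1 → ∀ j ∈ Finset.range (b + 1),
        ((p ^ (b + (r + 1) - (r + 1 + j))).totient : ℚ) *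
          ((p ^ (r + 1 + j)).totient * (p ^ min s (r + 1 + j) : ℕ) / (p ^ (r + 1 + j) : ℕ)) =
        (p : ℚ) ^ s * (1 - 1 / (p : ℚ)) * ((p ^ (b - j)).totient : ℚ) := by
      intro s hs j _
      rw [show b + (r + 1) - (r + 1 + j) = b - j by omega, min_eq_left (by omega),
        show r + 1 + j = (r + j) + 1 by ring, Nat.totient_prime_pow_succ hp]
      push_cast [hp.one_le]
      field_simp
      ring
    rw [Finset.sum_congr rfl (h1 r (by omega)), ← Finset.mul_sum] at ih
    rw [Finset.sum_congr rfl (h1 (r + 1) le_rfl), ← Finset.mul_sum]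
    have h2 := Finset.sum_range_reflect (fun j => ((p ^ j).totient : ℚ)) (b + 1)
    simp only [Nat.add_sub_cancel] at h2
    rw [h2, sum_range_totient_prime_pow hp] at ih ⊢
    rw [← eq_sub_iff_add_eq] at ih
    rw [ih]
    push_cast
    field_simp
    ring

lemma sum_divisors_totient_mul {q m : ℕ} (hq : q ≠ 0) (hm : m ∣ q) :
    ∑ g ∈ q.divisors, ((q / g).totient : ℚ) * (g.totient * m.gcd g / g) =
      q * calN m * ∏ p ∈ q.primeFactors, (1 - 1 / (p : ℚ) ^ 2) := by
  have hm0 : m ≠ 0 := ne_zero_of_dvd_ne_zero hq hm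
  have hmul := isMultiplicative_totientQ.mul (isMultiplicative_totientGcd m)
  have hpp : ∀ n, (totientQ * totientGcd m) n =
      ∑ g ∈ n.divisors, ((n / g).totient : ℚ) * (g.totient * m.gcd g / g) := by
    intro n
    rw [ArithmeticFunction.mul_apply,
      Nat.sum_divisorsAntidiagonal' (f := fun x y => totientQ x * totientGcd m y)]
    rfl
  have hN : calN m = ∏ p ∈ q.primeFactors,
      (1 + (m.factorization p) * ((p : ℚ) - 1) / ((p : ℚ) + 1)) := by
    refine Finset.prod_subset (Nat.primeFactors_mono hm hq) fun p _ hp => ?_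
    have : m.factorization p = 0 := by
      rwa [← Finsupp.notMem_support_iff, Nat.support_factorization]
    simp [this]
  have hqp : (q : ℚ) = ∏ p ∈ q.primeFactors, (p : ℚ) ^ q.factorization p := by
    conv_lhs => rw [← Nat.prod_factorization_pow_eq_self hq]
    simp [Finsupp.prod]
  rw [← hpp, hmul.multiplicative_factorization _ hq, hN]
  conv_rhs => rw [hqp]
  rw [Finsupp.prod, Nat.support_factorization, ← Finset.prod_mul_distrib,
    ← Finset.prod_mul_distrib]
  refine Finset.prod_congr rfl fun p hp => ?_
  have hpr := Nat.prime_of_mem_primeFactors hp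
  rw [hpp, Nat.sum_divisors_prime_pow hpr]
  rw [← sum_totient_prime_pow_mul p hpr _ _ ((Nat.factorization_le_iff_dvd hm0 hq).2 hm p)
    (hpr.factorization_pos_of_dvd hq (Nat.dvd_of_mem_primeFactors hp))]
  refine Finset.sum_congr rfl fun j hj => ?_
  rw [Finset.mem_range] at hj
  rw [gcd_prime_pow hm0 hpr, Nat.pow_div (by omega) hpr.pos]

/-- Pairs `(x, y)` generating the unit ideal of `ℤ/q`; the parameter `n` selects the action. -/
def PrimVec (q _n : ℕ) : Type := {v : ZMod q × ZMod q // IsCoprime v.1 v.2}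

noncomputable instance (q n : ℕ) [NeZero q] : Fintype (PrimVec q n) := by
  unfold PrimVec
  classical infer_instance

lemma units_int_cast_mul_self {R : Type*} [Ring R] (ε : ℤˣ) :
    (((ε : ℤ) : R)) * ((ε : ℤ) : R) = 1 := by
  rw [← Int.cast_mul, Int.units_coe_mul_self, Int.cast_one]

/-- `(ε, b)` acts on primitive vectors by `ε • [1, n b; 0, 1]`. -/
instance (q n : ℕ) : MulAction (ℤˣ × Multiplicative (ZMod q)) (PrimVec q n) where
  smul h v := ⟨(((h.1 : ℤ) : ZMod q) * (v.1.1 + n * h.2.toAdd * v.1.2),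
      ((h.1 : ℤ) : ZMod q) * v.1.2), by
    obtain ⟨s, t, hst⟩ := v.2
    have he := units_int_cast_mul_self (R := ZMod q) h.1
    refine ⟨((h.1 : ℤ) : ZMod q) * s, ((h.1 : ℤ) : ZMod q) * (t - s * (n * h.2.toAdd)), ?_⟩
    linear_combination he * (s * v.1.1 + t * v.1.2) + hst⟩
  one_smul v := by
    apply Subtype.ext
    apply Prod.ext
    · change (((1 : ℤˣ) : ℤ) : ZMod q) * (v.1.1 + n * (0 : ZMod q) * v.1.2) = v.1.1
      simp
    · change (((1 : ℤˣ) : ℤ) : ZMod q) * v.1.2 = v.1.2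
      simp
  mul_smul h k v := by
    apply Subtype.ext
    apply Prod.ext
    · change (((h.1 * k.1 : ℤˣ) : ℤ) : ZMod q) *
          (v.1.1 + n * (h.2.toAdd + k.2.toAdd) * v.1.2) =
        ((h.1 : ℤ) : ZMod q) * (((k.1 : ℤ) : ZMod q) * (v.1.1 + n * k.2.toAdd * v.1.2) +
          n * h.2.toAdd * (((k.1 : ℤ) : ZMod q) * v.1.2))
      push_cast
      ring
    · change (((h.1 * k.1 : ℤˣ) : ℤ) : ZMod q) * v.1.2 =
        ((h.1 : ℤ) : ZMod q) * (((k.1 : ℤ) : ZMod q) * v.1.2)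
      push_cast
      ring

lemma PrimVec.smul_fst {q n : ℕ} (h : ℤˣ × Multiplicative (ZMod q)) (v : PrimVec q n) :
    (h • v).1.1 = ((h.1 : ℤ) : ZMod q) * (v.1.1 + n * h.2.toAdd * v.1.2) := rfl

lemma PrimVec.smul_snd {q n : ℕ} (h : ℤˣ × Multiplicative (ZMod q)) (v : PrimVec q n) :
    (h • v).1.2 = ((h.1 : ℤ) : ZMod q) * v.1.2 := rfl

lemma PrimVec.neg_smul_ne {q n : ℕ} (hq : 5 ≤ q) (b : Multiplicative (ZMod q))
    (v : PrimVec q n) : ((-1 : ℤˣ), b) • v ≠ v := by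
  intro h
  have h1 := congrArg (fun w : PrimVec q n => w.1.1) h
  have h2 := congrArg (fun w : PrimVec q n => w.1.2) h
  simp only [PrimVec.smul_fst, PrimVec.smul_snd] at h1 h2
  push_cast at h1 h2
  obtain ⟨s, t, hst⟩ := v.2
  have : ((4 : ℕ) : ZMod q) = 0 := by
    push_cast
    linear_combination (-4 : ZMod q) * hst - 2 * s * h1 - 2 * t * h2 + s * n * b.toAdd * h2
  rw [ZMod.natCast_eq_zero_iff] at this
  exact absurd (Nat.le_of_dvd (by norm_num) this) (by omega)

lemma PrimVec.one_smul_eq_iff {q n : ℕ} (b : Multiplicative (ZMod q)) (v : PrimVec q n) :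
    ((1 : ℤˣ), b) • v = v ↔ n * b.toAdd * v.1.2 = 0 := by
  constructor
  · intro h
    have h1 := congrArg (fun w : PrimVec q n => w.1.1) h
    simpa [PrimVec.smul_fst] using h1
  · intro h
    apply Subtype.ext
    apply Prod.ext
    · simp [PrimVec.smul_fst, h]
    · simp [PrimVec.smul_snd]

lemma isCoprime_zmod_iff {q : ℕ} (x y : ℕ) :
    IsCoprime (x : ZMod q) (y : ZMod q) ↔ (q.gcd y).Coprime x := by
  constructor
  · rintro ⟨s, t, h⟩
    have key : (1 : ZMod ((q.gcd y).gcd x)) = 0 := by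
      have h := congrArg (ZMod.castHom ((Nat.gcd_dvd_left (q.gcd y) x).trans (Nat.gcd_dvd_left q y))
        (ZMod ((q.gcd y).gcd x))) h
      have hx : (x : ZMod ((q.gcd y).gcd x)) = 0 :=
        (ZMod.natCast_eq_zero_iff _ _).2 (Nat.gcd_dvd_right _ _)
      have hy : (y : ZMod ((q.gcd y).gcd x)) = 0 :=
        (ZMod.natCast_eq_zero_iff _ _).2 ((Nat.gcd_dvd_left _ _).trans (Nat.gcd_dvd_right _ _))
      simpa [-ZMod.castHom_apply, hx, hy] using h.symm
    have : ((1 : ℕ) : ZMod ((q.gcd y).gcd x)) = 0 := by simpa using key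
    rw [ZMod.natCast_eq_zero_iff] at this
    exact Nat.dvd_one.1 this
  · intro h
    obtain ⟨u, v, huv⟩ := Nat.isCoprime_iff_coprime.2 h
    have hg := Nat.gcd_eq_gcd_ab q y
    rw [hg] at huv
    have := congrArg (Int.cast : ℤ → ZMod q) huv
    push_cast at this
    refine ⟨v, u * (q.gcdB y : ℤ), ?_⟩
    simp only [CharP.cast_eq_zero, zero_mul, zero_add] at this
    linear_combination this

lemma sum_zmod_val {q : ℕ} [NeZero q] {M : Type*} [AddCommMonoid M] (f : ℕ → M) :
    ∑ x : ZMod q, f x.val = ∑ i ∈ Finset.range q, f i := by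
  obtain ⟨k, rfl⟩ := Nat.exists_eq_succ_of_ne_zero (NeZero.ne q)
  exact Fin.sum_univ_eq_sum_range f (k + 1)

lemma sum_card_fixedBy_primVec {q n : ℕ} [NeZero q] (hq : 5 ≤ q) :
    ∑ h : ℤˣ × Multiplicative (ZMod q), Nat.card (MulAction.fixedBy (PrimVec q n) h) =
      ∑ y ∈ Finset.range q, q / q.gcd y * (q.gcd y).totient * q.gcd (n * y) := by
  classical
  have hneg : ∀ b : Multiplicative (ZMod q),
      Nat.card (MulAction.fixedBy (PrimVec q n) ((-1 : ℤˣ), b)) = 0 := by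
    intro b
    have : IsEmpty (MulAction.fixedBy (PrimVec q n) ((-1 : ℤˣ), b)) :=
      ⟨fun v => PrimVec.neg_smul_ne hq b v.1 v.2⟩
    exact Nat.card_of_isEmpty
  have hpos : ∀ b : ZMod q,
      Nat.card (MulAction.fixedBy (PrimVec q n) ((1 : ℤˣ), Multiplicative.ofAdd b)) =
      ∑ y : ZMod q, ∑ x : ZMod q,
        if IsCoprime x y ∧ (n : ZMod q) * b * y = 0 then 1 else 0 := by
    intro b
    rw [Finset.sum_comm, ← Finset.sum_product', Finset.univ_product_univ, Finset.sum_boole,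
      Nat.cast_id, ← Fintype.card_subtype, ← Nat.card_eq_fintype_card]
    refine Nat.card_congr ⟨fun v => ⟨v.1.1, v.1.2, (PrimVec.one_smul_eq_iff _ _).1 v.2⟩,
      fun w => ⟨⟨w.1, w.2.1⟩, (PrimVec.one_smul_eq_iff _ _).2 w.2.2⟩, fun _ => rfl, fun _ => rfl⟩
  rw [Fintype.sum_prod_type, UnitsInt.univ, Finset.sum_pair (by decide)]
  simp only [hneg, Finset.sum_const_zero, add_zero]
  rw [← Equiv.sum_comp Multiplicative.ofAdd]
  simp only [hpos]
  rw [Finset.sum_comm, ← sum_zmod_val]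
  refine Finset.sum_congr rfl fun y _ => ?_
  have h1 : ∑ x : ZMod q, (if IsCoprime x y then 1 else 0) =
      q / q.gcd y.val * (q.gcd y.val).totient := by
    rw [← card_filter_coprime_range (Nat.gcd_dvd_left q y.val), Finset.card_filter, ← sum_zmod_val]
    refine Finset.sum_congr rfl fun x _ => ?_
    refine if_congr ?_ rfl rfl
    rw [← isCoprime_zmod_iff, ZMod.natCast_zmod_val, ZMod.natCast_zmod_val]
  have h2 : ∑ b : ZMod q, (if (n : ZMod q) * b * y = 0 then 1 else 0) = q.gcd (n * y.val) := by
    rw [← card_filter_dvd_mul_range (NeZero.pos q), Finset.card_filter, ← sum_zmod_val]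
    refine Finset.sum_congr rfl fun b _ => ?_
    refine if_congr ?_ rfl rfl
    rw [← ZMod.natCast_eq_zero_iff]
    push_cast
    rw [ZMod.natCast_zmod_val, ZMod.natCast_zmod_val, mul_right_comm]
  rw [← h1, ← h2, Finset.sum_mul_sum, Finset.sum_comm]
  refine Finset.sum_congr rfl fun x _ => Finset.sum_congr rfl fun b _ => ?_
  by_cases hc : IsCoprime x y <;> simp [hc]

lemma sum_range_gcd_eq_sum_divisors {q : ℕ} (f : ℕ → ℚ) :
    ∑ y ∈ Finset.range q, f (q.gcd y) = ∑ g ∈ q.divisors, ((q / g).totient : ℚ) * f g := by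
  rcases Nat.eq_zero_or_pos q with rfl | hq
  · simp
  rw [← Finset.sum_fiberwise_of_maps_to (t := q.divisors) (g := fun y => q.gcd y)
    (fun y _ => Nat.mem_divisors.2 ⟨Nat.gcd_dvd_left q y, hq.ne'⟩)]
  refine Finset.sum_congr rfl fun g hg => ?_
  rw [Nat.totient_div_of_dvd (Nat.dvd_of_mem_divisors hg), ← nsmul_eq_mul, ← Finset.sum_const]
  exact Finset.sum_congr rfl fun y hy => by rw [(Finset.mem_filter.1 hy).2]

lemma card_orbits_primVec {q n : ℕ} (hq : 5 ≤ q) (hn : 0 < n) (hdvd : n ∣ q) :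
    (Nat.card (MulAction.orbitRel.Quotient (ℤˣ × Multiplicative (ZMod q)) (PrimVec q n)) : ℚ) =
      (n : ℚ) * (q : ℚ) * calN (q / n) / 2 * ∏ p ∈ q.primeFactors, (1 - 1 / (p : ℚ) ^ 2) := by
  classical
  have : NeZero q := ⟨by omega⟩
  have hq0 : (q : ℚ) ≠ 0 := by exact_mod_cast NeZero.ne q
  have hb := MulAction.sum_card_fixedBy_eq_card_orbits_mul_card_group
    (ℤˣ × Multiplicative (ZMod q)) (PrimVec q n)
  simp only [← Nat.card_eq_fintype_card] at hb
  rw [sum_card_fixedBy_primVec hq] at hb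
  have hcard : Nat.card (ℤˣ × Multiplicative (ZMod q)) = 2 * q := by
    simp
  rw [hcard] at hb
  obtain ⟨m, rfl⟩ := hdvd
  rw [Nat.mul_div_cancel_left _ hn]
  have hterm : ∀ y ∈ Finset.range (n * m),
      (((n * m / (n * m).gcd y * ((n * m).gcd y).totient * (n * m).gcd (n * y) : ℕ)) : ℚ) =
      (fun g : ℕ => (n * (n * m : ℕ) : ℚ) * (g.totient * m.gcd g / g)) ((n * m).gcd y) := by
    intro y _
    have hg : ((n * m).gcd y : ℚ) ≠ 0 := by
      exact_mod_cast (Nat.gcd_pos_of_pos_left _ (NeZero.pos (n * m))).ne'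
    have hmg : m.gcd ((n * m).gcd y) = m.gcd y := by
      rw [← Nat.gcd_assoc, Nat.gcd_mul_left_right]
    simp only [hmg, Nat.gcd_mul_left n m y]
    rw [Nat.cast_mul, Nat.cast_mul, Nat.cast_div (Nat.gcd_dvd_left _ _) hg]
    push_cast
    field_simp
  have hb' := congrArg (Nat.cast : ℕ → ℚ) hb
  rw [Nat.cast_sum, Finset.sum_congr rfl hterm, sum_range_gcd_eq_sum_divisors
    (f := fun g : ℕ => (n * (n * m : ℕ) : ℚ) * (g.totient * m.gcd g / g))] at hb'
  have hfac : ∀ g ∈ (n * m).divisors, ((n * m / g).totient : ℚ) *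
      ((n * (n * m : ℕ) : ℚ) * (g.totient * m.gcd g / g)) = (n * (n * m : ℕ) : ℚ) *
      (((n * m / g).totient : ℚ) * (g.totient * m.gcd g / g)) := fun g _ => by ring
  rw [Finset.sum_congr rfl hfac, ← Finset.mul_sum,
    sum_divisors_totient_mul (NeZero.ne _) (Dvd.intro_left n rfl), Nat.cast_mul _ (2 * _),
    Nat.cast_mul 2] at hb'
  have : ((2 : ℕ) : ℚ) * (n * m : ℕ) ≠ 0 := mul_ne_zero (by norm_num) hq0
  apply mul_right_cancel₀ this
  rw [← hb']
  push_cast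
  ring

/-- The cusp `a / c`, where `c = 0` gives `∞`. -/
def toCusp (a c : ℤ) : Option ℚ := if (c : ℚ) = 0 then none else some ((a : ℚ) / c)

/-- The numerator of a cusp in lowest terms. -/
def cuspNum : Option ℚ → ℤ
  | none => 1
  | some t => t.num

/-- The denominator of a cusp in lowest terms. -/
def cuspDen : Option ℚ → ℤ
  | none => 0
  | some t => t.den

lemma isCoprime_cuspNum_cuspDen (x : Option ℚ) : IsCoprime (cuspNum x) (cuspDen x) := by
  cases x with
  | none => exact isCoprime_one_left
  | some t => exact Int.isCoprime_iff_gcd_eq_one.2 t.reduced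

lemma toCusp_cuspNum_cuspDen (x : Option ℚ) : toCusp (cuspNum x) (cuspDen x) = x := by
  cases x with
  | none => simp [toCusp, cuspDen]
  | some t => simp [toCusp, cuspDen, cuspNum, Rat.num_div_den]

lemma eq_units_mul_of_mul_eq_mul {a c a' c' : ℤ} (h : IsCoprime a c) (h' : IsCoprime a' c')
    (heq : a * c' = a' * c) : ∃ ε : ℤˣ, a' = ε * a ∧ c' = ε * c := by
  obtain ⟨s, t, hst⟩ := h
  obtain ⟨s', t', hst'⟩ := h'
  have hu : (s * a' + t * c') * (s' * a + t' * c) = 1 := by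
    linear_combination (t * s' - s * t') * heq + (s' * a' + t' * c') * hst + hst'
  refine ⟨⟨s * a' + t * c', s' * a + t' * c, hu, by rw [mul_comm, hu]⟩, ?_, ?_⟩
  · simp only
    linear_combination (-a') * hst - t * heq
  · simp only
    linear_combination (-c') * hst + s * heq

lemma toCusp_eq_iff {a c a' c' : ℤ} (h : IsCoprime a c) (h' : IsCoprime a' c') :
    toCusp a c = toCusp a' c' ↔ ∃ ε : ℤˣ, a' = ε * a ∧ c' = ε * c := by
  constructor
  · intro heq
    apply eq_units_mul_of_mul_eq_mul h h'
    unfold toCusp at heq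
    split_ifs at heq with h1 h2 h2
    · simp only [Int.cast_eq_zero] at h1 h2
      simp [h1, h2]
    · have := Option.some.inj heq
      rw [div_eq_div_iff h1 h2] at this
      exact_mod_cast this
  · rintro ⟨ε, rfl, rfl⟩
    rcases Int.units_eq_one_or ε with rfl | rfl <;> simp [toCusp]

lemma moebius_toCusp (g : Matrix.SpecialLinearGroup (Fin 2) ℤ) {a c : ℤ} (h : IsCoprime a c) :
    moebius g (toCusp a c) =
      toCusp (g.1 0 0 * a + g.1 0 1 * c) (g.1 1 0 * a + g.1 1 1 * c) := by
  by_cases hc : (c : ℚ) = 0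
  · have hc' : c = 0 := by exact_mod_cast hc
    subst hc'
    have ha : (a : ℚ) ≠ 0 := by
      rintro ha
      have : a = 0 := by exact_mod_cast ha
      subst this
      exact not_isCoprime_zero_zero h
    simp only [toCusp, moebius, Int.cast_zero, if_true, mul_zero, add_zero, Int.cast_mul,
      mul_eq_zero, ha, or_false]
    split_ifs with h0
    · rfl
    · rw [mul_div_mul_right _ _ ha]
  · have key : ((g.1 1 0 : ℤ) : ℚ) * (a / c) + (g.1 1 1 : ℤ) =
        ((g.1 1 0 * a + g.1 1 1 * c : ℤ) : ℚ) / c := by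
      push_cast
      field_simp
    have key' : ((g.1 0 0 : ℤ) : ℚ) * (a / c) + (g.1 0 1 : ℤ) =
        ((g.1 0 0 * a + g.1 0 1 * c : ℤ) : ℚ) / c := by
      push_cast
      field_simp
    simp only [toCusp, moebius, hc, if_false, key, key', div_eq_zero_iff, or_false]
    split_ifs with h0
    · rfl
    · rw [div_div_div_cancel_right₀ hc]

lemma isCoprime_mulVec (g : Matrix.SpecialLinearGroup (Fin 2) ℤ) {a c : ℤ} (h : IsCoprime a c) :
    IsCoprime (g.1 0 0 * a + g.1 0 1 * c) (g.1 1 0 * a + g.1 1 1 * c) := by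
  obtain ⟨s, t, hst⟩ := h
  have hdet := g.2
  rw [Matrix.det_fin_two] at hdet
  exact ⟨s * g.1 1 1 - t * g.1 1 0, t * g.1 0 0 - s * g.1 0 1, by
    linear_combination (s * a + t * c) * hdet + hst⟩

lemma moebius_eq_iff (g : Matrix.SpecialLinearGroup (Fin 2) ℤ) (x y : Option ℚ) :
    moebius g x = y ↔ ∃ ε : ℤˣ,
      cuspNum y = ε * (g.1 0 0 * cuspNum x + g.1 0 1 * cuspDen x) ∧
      cuspDen y = ε * (g.1 1 0 * cuspNum x + g.1 1 1 * cuspDen x) := by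
  have hx := isCoprime_cuspNum_cuspDen x
  rw [← toCusp_eq_iff (isCoprime_mulVec g hx) (isCoprime_cuspNum_cuspDen y),
    ← moebius_toCusp g hx, toCusp_cuspNum_cuspDen, toCusp_cuspNum_cuspDen]

lemma mem_GammaQN_iff {q n : ℕ} (hdvd : n ∣ q) (g : Matrix.SpecialLinearGroup (Fin 2) ℤ) :
    g ∈ GammaQN q n ↔ (g.1 0 0 : ZMod q) = 1 ∧ (g.1 1 1 : ZMod q) = 1 ∧ (g.1 1 0 : ZMod q) = 0 ∧
      ∃ b : ZMod q, (g.1 0 1 : ZMod q) = n * b := by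
  have hup : g ∈ GammaUpper n ↔ ∃ b : ZMod q, (g.1 0 1 : ZMod q) = n * b := by
    change ((g.1 0 1 : ℤ) : ZMod n) = 0 ↔ _
    constructor
    · intro h
      obtain ⟨b, hb⟩ := (ZMod.intCast_zmod_eq_zero_iff_dvd _ _).1 h
      exact ⟨b, by rw [hb]; push_cast; rfl⟩
    · rintro ⟨b, hb⟩
      have := congrArg (ZMod.castHom hdvd (ZMod n)) hb
      rw [map_mul, map_natCast, map_intCast] at this
      simpa using this
  rw [GammaQN, Subgroup.mem_inf, Gamma1_mem, hup, and_assoc, and_assoc]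

/-- Coprime integral vectors whose reductions differ by `[1, n b; 0, 1]` are related by an element
of `Γ_q^n`. -/
lemma exists_mem_GammaQN {q n : ℕ} (hdvd : n ∣ q) {a c a' c' : ℤ} (h : IsCoprime a c)
    (h' : IsCoprime a' c') (b : ZMod q) (h1 : (a' : ZMod q) = a + n * b * c)
    (h2 : (c' : ZMod q) = c) :
    ∃ g ∈ GammaQN q n, a' = g.1 0 0 * a + g.1 0 1 * c ∧ c' = g.1 1 0 * a + g.1 1 1 * c := by
  obtain ⟨s, t, hst⟩ := h
  obtain ⟨s', t', hst'⟩ := h'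
  obtain ⟨e, rfl⟩ := ZMod.intCast_surjective b
  have hmod := congrArg (Int.cast : ℤ → ZMod q) hst
  have hmod' := congrArg (Int.cast : ℤ → ZMod q) hst'
  push_cast at hmod hmod'
  rw [h1, h2] at hmod'
  set k : ℤ := t' * s - (s' * t) + s' * n * e * s with hk
  have hdet : Matrix.det !![a' * s - (a' * k - t') * c, a' * t + (a' * k - t') * a;
      c' * s - (c' * k + s') * c, c' * t + (c' * k + s') * a] = 1 := by
    rw [Matrix.det_fin_two_of]
    linear_combination (s' * a' + t' * c') * hst + hst'
  obtain ⟨g, h00, h01, h10, h11⟩ : ∃ g : Matrix.SpecialLinearGroup (Fin 2) ℤ,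
      g.1 0 0 = a' * s - (a' * k - t') * c ∧ g.1 0 1 = a' * t + (a' * k - t') * a ∧
      g.1 1 0 = c' * s - (c' * k + s') * c ∧ g.1 1 1 = c' * t + (c' * k + s') * a :=
    ⟨⟨_, hdet⟩, rfl, rfl, rfl, rfl⟩
  refine ⟨g, (mem_GammaQN_iff hdvd g).2 ?_, ?_, ?_⟩
  · rw [h00, h01, h10, h11]
    push_cast [hk]
    rw [h1, h2]
    refine ⟨?_, ?_, ?_, e, ?_⟩
    · linear_combination (a + n * e * c : ZMod q) * (s' * hmod - s * hmod') + hmod'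
    · linear_combination hmod - (a : ZMod q) * (s' * hmod - s * hmod')
    · linear_combination (c : ZMod q) * (s' * hmod - s * hmod')
    · linear_combination (a : ZMod q) * ((-t + n * e * s) * hmod' + t' * hmod) + n * e * hmod
  · rw [h00, h01]
    linear_combination (-a') * hst
  · rw [h10, h11]
    linear_combination (-c') * hst

lemma exists_coprime_lift {q : ℕ} [NeZero q] {x y : ZMod q} (h : IsCoprime x y) :
    ∃ a c : ℤ, IsCoprime a c ∧ (a : ZMod q) = x ∧ (c : ZMod q) = y := by
  set c := y.val + q with hc
  have hcy : (c : ZMod q) = y := by simp [hc]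
  have : NeZero c := ⟨by have := NeZero.pos q; omega⟩
  rw [← hcy, ← ZMod.natCast_zmod_val x, isCoprime_zmod_iff] at h
  obtain ⟨u, hu⟩ := ZMod.unitsMap_surjective (Nat.gcd_dvd_right q c)
    (ZMod.unitOfCoprime x.val h.symm)
  have hmod : x.val ≡ (u : ZMod c).val [MOD q.gcd c] := by
    rw [← ZMod.natCast_eq_natCast_iff]
    have := congrArg Units.val hu
    rw [ZMod.unitsMap_val, ZMod.coe_unitOfCoprime, ZMod.cast_eq_val] at this
    exact this.symm
  obtain ⟨z, hz1, hz2⟩ := Nat.chineseRemainder' hmod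
  refine ⟨z, c, Nat.isCoprime_iff_coprime.2 ?_, ?_, by exact_mod_cast hcy⟩
  · rw [Nat.coprime_iff_gcd_eq_one, hz2.gcd_eq]
    exact ZMod.val_coe_unit_coprime u
  · rw [Int.cast_natCast, (ZMod.natCast_eq_natCast_iff _ _ _).2 hz1, ZMod.natCast_zmod_val]

/-- The reduction modulo `q` of a cusp in lowest terms. -/
def cuspVec (q n : ℕ) (x : Option ℚ) : PrimVec q n :=
  ⟨(cuspNum x, cuspDen x), by
    simpa using (isCoprime_cuspNum_cuspDen x).map (Int.castRingHom (ZMod q))⟩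

lemma cuspVec_fst (q n : ℕ) (x : Option ℚ) : (cuspVec q n x).1.1 = cuspNum x := rfl

lemma cuspVec_snd (q n : ℕ) (x : Option ℚ) : (cuspVec q n x).1.2 = cuspDen x := rfl

lemma cuspRel_iff {q n : ℕ} (hdvd : n ∣ q) (x y : Option ℚ) :
    cuspRel (GammaQN q n) x y ↔
      ∃ h : ℤˣ × Multiplicative (ZMod q), h • cuspVec q n x = cuspVec q n y := by
  constructor
  · rintro ⟨g, hg, hxy⟩
    obtain ⟨h00, h11, h10, b, h01⟩ := (mem_GammaQN_iff hdvd g).1 hg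
    obtain ⟨ε, h1, h2⟩ := (moebius_eq_iff g x y).1 hxy
    refine ⟨(ε, Multiplicative.ofAdd b), Subtype.ext (Prod.ext ?_ ?_)⟩
    · rw [PrimVec.smul_fst]
      simp [cuspVec_fst, cuspVec_snd, h1, h00, h01]
    · rw [PrimVec.smul_snd]
      simp [cuspVec_snd, h2, h10, h11]
  · rintro ⟨⟨ε, b⟩, h⟩
    have h1 := congrArg (fun w : PrimVec q n => w.1.1) h
    have h2 := congrArg (fun w : PrimVec q n => w.1.2) h
    simp only [PrimVec.smul_fst, PrimVec.smul_snd, cuspVec_fst, cuspVec_snd] at h1 h2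
    have he := units_int_cast_mul_self (R := ZMod q) ε
    obtain ⟨g, hg, hg1, hg2⟩ := exists_mem_GammaQN (a' := ε * cuspNum y) (c' := ε * cuspDen y)
      hdvd (isCoprime_cuspNum_cuspDen x)
      ((isCoprime_mul_unit_left ε.isUnit _ _).2 (isCoprime_cuspNum_cuspDen y)) b.toAdd
      (by
        push_cast
        linear_combination (-((ε : ℤ) : ZMod q)) * h1 +
          (cuspNum x + n * b.toAdd * cuspDen x : ZMod q) * he)
      (by
        push_cast
        linear_combination (-((ε : ℤ) : ZMod q)) * h2 + (cuspDen x : ZMod q) * he)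
    refine ⟨g, hg, (moebius_eq_iff g x y).2 ⟨ε, ?_, ?_⟩⟩
    · rw [← hg1, ← mul_assoc, Int.units_coe_mul_self, one_mul]
    · rw [← hg2, ← mul_assoc, Int.units_coe_mul_self, one_mul]

lemma numCusps_GammaQN {q n : ℕ} [NeZero q] (hdvd : n ∣ q) :
    numCusps (GammaQN q n) =
      Nat.card (MulAction.orbitRel.Quotient (ℤˣ × Multiplicative (ZMod q)) (PrimVec q n)) := by
  have hrel : ∀ x y, cuspRel (GammaQN q n) x y →
      (Quotient.mk _ (cuspVec q n x) :
        MulAction.orbitRel.Quotient (ℤˣ × Multiplicative (ZMod q)) (PrimVec q n)) =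
      Quotient.mk _ (cuspVec q n y) := by
    intro x y hxy
    obtain ⟨h, hh⟩ := (cuspRel_iff hdvd x y).1 hxy
    exact (Quotient.sound (s := MulAction.orbitRel _ _) ⟨h, hh⟩).symm
  refine Nat.card_eq_of_bijective (Quot.lift _ hrel) ⟨?_, ?_⟩
  · rintro ⟨x⟩ ⟨y⟩ hxy
    obtain ⟨h, hh⟩ := Quotient.exact (s := MulAction.orbitRel _ _) hxy.symm
    exact Quot.sound ((cuspRel_iff hdvd x y).2 ⟨h, hh⟩)
  · rintro ⟨v⟩
    obtain ⟨a, c, hac, h1, h2⟩ := exists_coprime_lift v.2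
    refine ⟨Quot.mk _ (toCusp a c), ?_⟩
    set x := toCusp a c with hx
    obtain ⟨ε, ha, hc⟩ := (toCusp_eq_iff (isCoprime_cuspNum_cuspDen x) hac).1
      ((toCusp_cuspNum_cuspDen x).trans hx)
    have hv : (ε, Multiplicative.ofAdd (0 : ZMod q)) • cuspVec q n x = v := by
      refine Subtype.ext (Prod.ext ?_ ?_)
      · rw [PrimVec.smul_fst, ← h1, ha]
        simp [cuspVec_fst]
      · rw [PrimVec.smul_snd, ← h2, hc]
        simp [cuspVec_snd]
    exact (Quotient.sound (s := MulAction.orbitRel _ _) ⟨_, hv⟩).symm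

theorem stmt7 (q n : ℕ) (hq : 5 ≤ q) (hn : 0 < n) (hdvd : n ∣ q) :
    (numCusps (GammaQN q n) : ℚ) =
      (n : ℚ) * (q : ℚ) * calN (q / n) / 2 * ∏ p ∈ q.primeFactors, (1 - 1 / (p : ℚ) ^ 2) := by
  have : NeZero q := ⟨by omega⟩
  rw [numCusps_GammaQN hdvd, card_orbits_primVec hq hn hdvd]
end
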